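/- Let k ≥ 2 and let F(z) ∈ ℂ[[z]] be a k-Mahler function. Then either F is a rational function, or the unit circle is a natural boundary for F (F cannot be analytically continued past any point of the unit circle). (Randé's theorem) -/

import Mathlib

open Metric Set

section Aux
open Filter Topology Polynomial

theorem reduce_pow (k d : ℕ) (hk : 2 ≤ k) (hd : 1 ≤ d) (a : ℕ → ℂ[X]) (had : a d ≠ 0) (f : ℂ → ℂ)
    (heq : ∀ z ∈ ball (0 : ℂ) 1,
      ∑ j ∈ Finset.range (d + 1), (a j).eval z * f (z ^ k ^ j) = 0) (n : ℕ) :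
    ∃ (b : ℂ[X]) (v : ℕ → ℂ[X]), b ≠ 0 ∧ ∀ z ∈ ball (0 : ℂ) 1,
      b.eval z * f (z ^ k ^ n) = ∑ j ∈ Finset.range d, (v j).eval z * f (z ^ k ^ j) := by
  induction n with
  | zero =>
    refine ⟨1, fun j => if j = 0 then 1 else 0, one_ne_zero, fun z hz => ?_⟩
    rw [Finset.sum_eq_single 0]
    · simp
    · intro j _ hj; simp [hj]
    · intro h; simp at h; omega
  | succ n ih =>
    obtain ⟨b, v, hb, h⟩ := ih
    obtain ⟨d, rfl⟩ : ∃ d', d = d' + 1 := ⟨d - 1, by omega⟩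
    refine ⟨a (d+1) * b.comp (X ^ k), fun j => (if j = 0 then 0 else
      a (d+1) * (v (j - 1)).comp (X ^ k)) - (v d).comp (X ^ k) * a j, ?_, fun z hz => ?_⟩
    · refine mul_ne_zero had ?_
      rw [← Polynomial.expand_eq_comp_X_pow]
      rwa [Ne, Polynomial.expand_eq_zero (by omega)]
    · have hzk : z ^ k ∈ ball (0:ℂ) 1 := by
        simp only [mem_ball_zero_iff, norm_pow] at hz ⊢
        exact pow_lt_one₀ (norm_nonneg _) hz (by omega)
      have h1 := h _ hzk
      have h2 := heq z hz
      rw [Finset.sum_range_succ] at h1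
      rw [Finset.sum_range_succ] at h2
      have e1 : ∀ m, (z ^ k) ^ k ^ m = z ^ k ^ (m+1) := fun m => by
        rw [← pow_mul, pow_succ']
      simp only [e1] at h1
      simp only [eval_sub, eval_mul, sub_mul, Finset.sum_sub_distrib, eval_comp, eval_pow, eval_X]
      rw [Finset.sum_range_succ']
      simp only [Nat.add_eq_zero_iff, one_ne_zero, and_false, if_false, if_true, eval_zero, zero_mul,
        add_zero, Nat.add_sub_cancel, eval_mul, eval_comp, eval_pow, eval_X]
      have e2 : ∑ x ∈ Finset.range (d+1), eval (z ^ k) (v d) * eval z (a x) * f (z ^ k ^ x)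
          = eval (z ^ k) (v d) * ∑ x ∈ Finset.range (d+1), eval z (a x) * f (z ^ k ^ x) := by
        rw [Finset.mul_sum]; exact Finset.sum_congr rfl fun _ _ => by ring
      have e3 : ∑ x ∈ Finset.range d, eval z (a (d+1)) * eval (z ^ k) (v x) * f (z ^ k ^ (x+1))
          = eval z (a (d+1)) * ∑ x ∈ Finset.range d, eval (z ^ k) (v x) * f (z ^ k ^ (x+1)) := by
        rw [Finset.mul_sum]; exact Finset.sum_congr rfl fun _ _ => by ring
      rw [e2, e3]
      linear_combination eval z (a (d+1)) * h1 + eval (z^k) (v d) * h2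

theorem exists_rel (k d M : ℕ) (hk : 2 ≤ k) (hd : 1 ≤ d) (a : ℕ → ℂ[X]) (had : a d ≠ 0) (f : ℂ → ℂ)
    (heq : ∀ z ∈ ball (0 : ℂ) 1,
      ∑ j ∈ Finset.range (d + 1), (a j).eval z * f (z ^ k ^ j) = 0) :
    ∃ c : ℕ → ℂ[X], (∃ i ∈ Finset.range (d+1), c i ≠ 0) ∧ ∀ z ∈ ball (0 : ℂ) 1,
      ∑ i ∈ Finset.range (d + 1), (c i).eval z * f (z ^ (k ^ M) ^ i) = 0 := by
  choose b v hb h using fun i => reduce_pow k d hk hd a had f heq (M * i)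
  have : ¬ LinearIndependent ℂ[X] (fun i : Fin (d+1) => fun j : Fin d => v i j) := by
    intro hl
    have := hl.fintype_card_le_finrank
    simp at this
  rw [Fintype.not_linearIndependent_iff] at this
  obtain ⟨p, hp, i0, hi0⟩ := this
  refine ⟨fun i => if hi : i < d+1 then p ⟨i, hi⟩ * b i else 0, ⟨i0, Finset.mem_range.2 i0.2, ?_⟩, fun z hz => ?_⟩
  · simp only [i0.2, dif_pos, Fin.eta]; exact mul_ne_zero hi0 (hb _)
  · rw [Finset.sum_range]
    have : ∀ i : Fin (d+1), eval z (if hi : (i:ℕ) < d+1 then p ⟨i, hi⟩ * b i else 0) * f (z ^ (k ^ M) ^ (i:ℕ))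
       = ∑ j : Fin d, eval z (p i) * eval z (v i j) * f (z ^ k ^ (j:ℕ)) := by
      intro i
      have := h i z hz
      rw [Finset.sum_range] at this
      simp only [i.2, dif_pos, Fin.eta, eval_mul, mul_assoc]
      rw [← pow_mul, this, Finset.mul_sum]
    rw [Finset.sum_congr rfl fun i _ => this i, Finset.sum_comm]
    refine Finset.sum_eq_zero fun j _ => ?_
    rw [← Finset.sum_mul]
    have := congrArg (eval z) (congrFun hp j)
    simp [eval_finsetSum] at this
    rw [this, zero_mul]

theorem exists_rel' (K D : ℕ) (hK : 2 ≤ K) (f : ℂ → ℂ) (c : ℕ → ℂ[X])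
    (hc : ∃ i ∈ Finset.range (D+1), c i ≠ 0)
    (heq : ∀ z ∈ ball (0 : ℂ) 1, ∑ i ∈ Finset.range (D + 1), (c i).eval z * f (z ^ K ^ i) = 0) :
    ∃ (e i : ℕ) (P : ℕ → ℂ[X]), 1 ≤ e ∧ P 0 ≠ 0 ∧ P e ≠ 0 ∧ ∀ z ∈ ball (0 : ℂ) 1,
      ∑ j ∈ Finset.range (e + 1), (P j).eval z * f (z ^ K ^ (i + j)) = 0 := by
  classical
  set S := (Finset.range (D+1)).filter (fun i => c i ≠ 0) with hS
  have hne : S.Nonempty := by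
    obtain ⟨i, hi, h⟩ := hc; exact ⟨i, by simp [hS, h]; simpa using hi⟩
  set i := S.min' hne
  set J := S.max' hne
  have hi : i ∈ S := S.min'_mem hne
  have hJ : J ∈ S := S.max'_mem hne
  have hiJ : i ≤ J := S.min'_le _ hJ
  have hrel : ∀ z ∈ ball (0 : ℂ) 1,
      ∑ j ∈ Finset.range (J - i + 1), (c (i + j)).eval z * f (z ^ K ^ (i + j)) = 0 := by
    intro z hz
    rw [← heq z hz]
    have := Finset.sum_Ico_eq_sum_range (fun n => (c n).eval z * f (z ^ K ^ n)) i (J+1)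
    rw [show J + 1 - i = J - i + 1 by omega] at this
    rw [← this]
    refine Finset.sum_subset ?_ ?_
    · intro x hx
      simp [hS] at hJ hx ⊢; omega
    · intro x hx hx'
      have : c x = 0 := by
        by_contra h
        have hxS : x ∈ S := by simp [hS, h]; simpa using hx
        have h1 := S.min'_le _ hxS
        have h2 := S.le_max' _ hxS
        simp at hx'
        have := hx' h1
        omega
      simp [this]
  have hi0 : c i ≠ 0 := by simp [hS] at hi; exact hi.2
  have hJ0 : c J ≠ 0 := by simp [hS] at hJ; exact hJ.2
  rcases Nat.lt_or_ge i J with h | h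
  · refine ⟨J - i, i, fun j => c (i + j), by omega, by simpa using hi0, ?_, hrel⟩
    simpa [Nat.add_sub_cancel' hiJ] using hJ0
  · have hiJ' : i = J := le_antisymm hiJ h
    refine ⟨1, i, fun j => if j = 0 then c i else (c i).comp (X ^ K), le_rfl, by simpa using hi0, ?_,
      fun z hz => ?_⟩
    · simp only [one_ne_zero, if_false]
      rw [← Polynomial.expand_eq_comp_X_pow]
      rwa [Ne, Polynomial.expand_eq_zero (by omega)]
    · have hzk : z ^ K ∈ ball (0:ℂ) 1 := by
        simp only [mem_ball_zero_iff, norm_pow] at hz ⊢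
        exact pow_lt_one₀ (norm_nonneg _) hz (by omega)
      have h1 := hrel z hz
      have h2 := hrel _ hzk
      rw [← hiJ'] at h1 h2
      simp only [← pow_mul, ← pow_succ'] at h2
      simp [Finset.sum_range_succ] at h1 h2 ⊢
      rcases h1 with h1 | h1 <;> rcases h2 with h2 | h2 <;> simp [h1, h2]

theorem exists_root (k : ℕ) (hk : 2 ≤ k) (z₀ : ℂ) (hz : ‖z₀‖ = 1) (U : Set ℂ) (hU : IsOpen U)
    (hzU : z₀ ∈ U) : ∃ (M : ℕ) (w : ℂ), 1 ≤ M ∧ w ∈ U ∧ ‖w‖ = 1 ∧ w ^ (k ^ M) = w := by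
  obtain ⟨θ, hθ, rfl⟩ : ∃ θ : ℝ, 0 ≤ θ ∧ Complex.exp (θ * Complex.I) = z₀ := by
    obtain ⟨θ, rfl⟩ := (Complex.norm_eq_one_iff z₀).1 hz
    obtain ⟨n, hn⟩ := exists_nat_ge (-θ / (2 * Real.pi))
    refine ⟨θ + n * (2 * Real.pi), ?_, ?_⟩
    · rw [div_le_iff₀ Real.two_pi_pos] at hn; linarith
    · have : ((θ + n * (2 * Real.pi) : ℝ) : ℂ) * Complex.I = θ * Complex.I + n * (2 * Real.pi * Complex.I) := by
        push_cast; ring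
      rw [this, Complex.exp_add, Complex.exp_nat_mul_two_pi_mul_I, mul_one]
  have hcont : ContinuousAt (fun t : ℝ => Complex.exp (t * Complex.I)) θ := by fun_prop
  have hN : Tendsto (fun M : ℕ => (((k ^ M - 1 : ℕ) : ℕ) : ℝ)) atTop atTop := by
    refine tendsto_natCast_atTop_atTop.comp ?_
    refine (tendsto_sub_atTop_nat 1).comp (tendsto_pow_atTop_atTop_of_one_lt (by omega))
  have hlim : Tendsto (fun M : ℕ => 2 * Real.pi * (⌊θ / (2 * Real.pi) * ((k ^ M - 1 : ℕ) : ℝ)⌋₊ / ((k ^ M - 1 : ℕ) : ℝ)))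
      atTop (𝓝 θ) := by
    have := ((tendsto_nat_floor_mul_div_atTop (show 0 ≤ θ / (2 * Real.pi) by positivity)).comp hN).const_mul (2 * Real.pi)
    rw [mul_div_cancel₀ θ Real.two_pi_pos.ne'] at this
    exact this
  have h1 := (hcont.tendsto.comp hlim).eventually (hU.mem_nhds hzU)
  obtain ⟨M, hM, hM1⟩ := (h1.and (eventually_ge_atTop 1)).exists
  refine ⟨M, _, hM1, hM, ?_, ?_⟩
  · simp only [Function.comp]; exact Complex.norm_exp_ofReal_mul_I _
  · simp only [Function.comp]
    have hkM : 2 ≤ k ^ M := hk.trans (Nat.le_self_pow (by omega) k)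
    obtain ⟨N, hN⟩ : ∃ N, k ^ M = N + 1 := ⟨k ^ M - 1, by omega⟩
    have hN0 : (N : ℂ) ≠ 0 := by norm_cast; omega
    rw [hN, pow_succ]
    simp only [Nat.add_sub_cancel]
    rw [← Complex.exp_nat_mul]
    generalize ⌊θ / (2 * Real.pi) * (N : ℝ)⌋₊ = m
    have : (N : ℂ) * (((2 * Real.pi * ((m:ℝ) / (N:ℝ)) : ℝ) : ℂ) * Complex.I) = m * (2 * Real.pi * Complex.I) := by
      push_cast
      field_simp
    rw [this, Complex.exp_nat_mul_two_pi_mul_I, one_mul]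

theorem entire_poly (N : ℕ) : ∀ (E : ℂ → ℂ), Differentiable ℂ E → ∀ (R C : ℝ), 
    (∀ z, R ≤ ‖z‖ → ‖E z‖ ≤ C * ‖z‖ ^ N) → ∃ P : ℂ[X], ∀ z, E z = P.eval z := by
  induction N with
  | zero =>
    intro E hE R C hb
    have hbd : Bornology.IsBounded (range E) := by
      obtain ⟨C', hC'⟩ := (isCompact_closedBall (0:ℂ) R).exists_bound_of_continuousOn hE.continuous.continuousOn
      rw [isBounded_iff_forall_norm_le]
      refine ⟨max C C', ?_⟩
      rintro _ ⟨z, rfl⟩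
      rcases le_total R ‖z‖ with h | h
      · exact le_max_of_le_left (by simpa using hb z h)
      · exact le_max_of_le_right (hC' z (by simpa using h))
    exact ⟨Polynomial.C (E 0), fun z => by simpa using hE.apply_eq_apply_of_bounded hbd z 0⟩
  | succ N ih =>
    intro E hE R C hb
    have hd : Differentiable ℂ (dslope E 0) := by
      have := (Complex.differentiableOn_dslope (s := univ) (c := 0) (f := E) univ_mem).2 hE.differentiableOn
      exact differentiableOn_univ.1 this
    obtain ⟨P, hP⟩ := ih (dslope E 0) hd (max R 1) (C + ‖E 0‖) (by
      intro z hz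
      have h1 : 1 ≤ ‖z‖ := (le_max_right _ _).trans hz
      have hz0 : z ≠ 0 := by rintro rfl; simp at h1; linarith
      rw [dslope_of_ne _ hz0, slope_def_field, norm_div, sub_zero, div_le_iff₀ (by linarith)]
      have := hb z ((le_max_left _ _).trans hz)
      have h3 : 1 ≤ ‖z‖ ^ (N+1) := one_le_pow₀ h1
      calc ‖E z - E 0‖ ≤ ‖E z‖ + ‖E 0‖ := norm_sub_le _ _
        _ ≤ C * ‖z‖ ^ (N+1) + ‖E 0‖ * ‖z‖ ^ (N+1) := by
          gcongr; exact le_mul_of_one_le_right (norm_nonneg _) h3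
        _ = _ := by ring)
    refine ⟨P * X + Polynomial.C (E 0), fun z => ?_⟩
    have := sub_smul_dslope E 0 z
    simp at this ⊢
    rw [← hP]; linear_combination -this

theorem poly_bound (P : ℂ[X]) : ∃ (B : ℝ) (m : ℕ), 0 ≤ B ∧ ∀ z : ℂ, 1 ≤ ‖z‖ → ‖P.eval z‖ ≤ B * ‖z‖ ^ m := by
  refine ⟨∑ i ∈ Finset.range (P.natDegree + 1), ‖P.coeff i‖, P.natDegree, by positivity, fun z hz => ?_⟩
  rw [eval_eq_sum_range, Finset.sum_mul]
  refine (norm_sum_le _ _).trans (Finset.sum_le_sum fun i hi => ?_)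
  rw [norm_mul, norm_pow]
  gcongr
  simp at hi; omega

theorem poly_lower (P : ℂ[X]) (hP : P ≠ 0) : ∃ (δ R : ℝ), 0 < δ ∧ ∀ z : ℂ, R ≤ ‖z‖ → δ ≤ ‖P.eval z‖ := by
  by_cases hd : 0 < P.degree
  · have := P.tendsto_norm_atTop hd (l := cocompact ℂ) (z := id) (tendsto_norm_cocompact_atTop)
    have := this.eventually_ge_atTop 1
    rw [← Metric.cobounded_eq_cocompact, ← comap_norm_atTop, eventually_comap] at this
    obtain ⟨R, hR⟩ := eventually_atTop.1 this
    exact ⟨1, R, one_pos, fun z hz => hR _ hz z rfl⟩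
  · rw [eq_C_of_degree_le_zero (not_lt.1 hd)] at hP ⊢
    exact ⟨‖P.coeff 0‖, 0, by simpa using hP, fun z _ => by simp⟩

theorem rational_of_mero (Φ : ℂ → ℂ) (hm : ∀ z, MeromorphicAt Φ z) (R M : ℝ) (L : ℕ) 
    (ha : ∀ z, R ≤ ‖z‖ → AnalyticAt ℂ Φ z) (hb : ∀ z, R ≤ ‖z‖ → ‖Φ z‖ ≤ M * ‖z‖ ^ L) :
    ∃ P Q : ℂ[X], Q ≠ 0 ∧ ∀ z, Φ z * Q.eval z = P.eval z := by
  classical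
  have hfin : {z | ¬ AnalyticAt ℂ Φ z}.Finite := by
    have hsub : {z | ¬ AnalyticAt ℂ Φ z} ⊆ closedBall 0 R := by
      intro z hz
      by_contra h
      simp at h
      exact hz (ha z h.le)
    by_contra hinf
    obtain ⟨x, hx, hacc⟩ := Set.Infinite.exists_accPt_of_subset_isCompact hinf (isCompact_closedBall (0:ℂ) R) hsub
    rw [accPt_iff_frequently_nhdsNE] at hacc
    exact hacc ((hm x).eventually_analyticAt.mono fun y hy h => h hy)
  choose n hn using hm
  set S := hfin.toFinset
  set Q : ℂ[X] := ∏ p ∈ S, (X - C p) ^ n p with hQ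
  have hQ0 : Q ≠ 0 := Finset.prod_ne_zero_iff.2 fun p _ => pow_ne_zero _ (X_sub_C_ne_zero p)
  have hQan : ∀ (P : ℂ[X]) z, AnalyticAt ℂ (fun z => P.eval z) z := fun P z =>
    (P.differentiable.analyticAt z)
  have hE : Differentiable ℂ (fun z => Φ z * Q.eval z) := by
    intro z
    by_cases hz : AnalyticAt ℂ Φ z
    · exact (hz.mul (hQan Q z)).differentiableAt
    · have hzS : z ∈ S := by simp [S, hz]
      have hQ' : Q = (X - C z) ^ n z * ∏ p ∈ S.erase z, (X - C p) ^ n p := 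
        (Finset.mul_prod_erase S _ hzS).symm
      have := (hn z).mul (hQan (∏ p ∈ S.erase z, (X - C p) ^ n p) z)
      refine (this.congr (Eventually.of_forall fun y => ?_)).differentiableAt
      rw [hQ']
      simp only [eval_mul, eval_pow, eval_sub, eval_X, eval_C, Pi.mul_apply, smul_eq_mul]
      ring
  obtain ⟨B, m, hB, hBm⟩ := poly_bound Q
  obtain ⟨P, hP⟩ := entire_poly (L + m) _ hE (max R 1) (M * B) (by
    intro z hz
    rw [norm_mul, pow_add]
    have h1 := hb z ((le_max_left _ _).trans hz)
    have h2 := hBm z ((le_max_right _ _).trans hz)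
    calc _ ≤ (M * ‖z‖ ^ L) * (B * ‖z‖ ^ m) := mul_le_mul h1 h2 (norm_nonneg _) ((norm_nonneg _).trans h1)
      _ = _ := by ring)
  exact ⟨P, Q, hQ0, hP⟩

/-- identity principle -/
theorem mero_ident {f : ℂ → ℂ} {U : Set ℂ} (hf : MeromorphicOn f U) (hU : IsPreconnected U) {x : ℂ}
    (hx : x ∈ U) (h : ∀ᶠ t in 𝓝[≠] x, f t = 0) {y : ℂ} (hy : y ∈ U) : ∀ᶠ t in 𝓝[≠] y, f t = 0 := by
  rw [← meromorphicOrderAt_eq_top_iff] at h ⊢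
  by_contra h'
  exact hf.meromorphicOrderAt_ne_top_of_isPreconnected hU hy hx h' h

theorem mero_ident₂ {f g : ℂ → ℂ} {U : Set ℂ} (hf : MeromorphicOn f U) (hg : MeromorphicOn g U)
    (hU : IsPreconnected U) {x : ℂ}
    (hx : x ∈ U) (h : f =ᶠ[𝓝[≠] x] g) {y : ℂ} (hy : y ∈ U) : f =ᶠ[𝓝[≠] y] g := by
  have := mero_ident (f := f - g) (fun z hz => (hf z hz).sub (hg z hz)) hU hx
    (h.mono fun t ht => by simp [ht]) hy
  exact this.mono fun t ht => by simpa [sub_eq_zero] using ht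

theorem mero_scale {f : ℂ → ℂ} {a x : ℂ} (h : MeromorphicAt f (a * x)) :
    MeromorphicAt (fun t => f (a * t)) x :=
  MeromorphicAt.comp_analyticAt (g := fun t => a * t) h (by fun_prop)

theorem tendsto_scale {a : ℂ} (ha : a ≠ 0) (x : ℂ) : Tendsto (fun t => a * t) (𝓝[≠] x) (𝓝[≠] (a * x)) := by
  refine tendsto_nhdsWithin_of_tendsto_nhds_of_eventually_within _ 
    ((continuous_const_mul a).continuousAt.tendsto.mono_left nhdsWithin_le_nhds) ?_
  filter_upwards [self_mem_nhdsWithin] with t ht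
  simpa [ha] using ht

/-- the extension step -/
theorem extend_ball (K e : ℕ) (hK : 2 ≤ K) (he : 1 ≤ e) (C : ℕ → ℂ → ℂ) (hC : ∀ j, Differentiable ℂ (C j))
    (hCe : ∃ s, C e s ≠ 0) (ψ : ℂ → ℂ)
    (hrel : ∀ s : ℂ, s.re < 0 → ∑ j ∈ Finset.range (e+1), C j s * ψ ((K:ℂ) ^ j * s) = 0)
    (ε : ℝ) (hε : 0 < ε) (g : ℂ → ℂ) (hg : MeromorphicOn g (ball 0 ε))
    (hgψ : ∀ s ∈ ball (0:ℂ) ε, s.re < 0 → g s = ψ s) (n : ℕ) :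
    ∃ G : ℂ → ℂ, MeromorphicOn G (ball 0 (ε * K ^ n)) ∧ 
      ∀ s ∈ ball (0:ℂ) (ε * K ^ n), s.re < 0 → G =ᶠ[𝓝[≠] s] ψ := by
  have hK0 : (K:ℂ) ≠ 0 := by norm_cast; omega
  have hKR : (0:ℝ) < K := by norm_cast; omega
  have hKR1 : (1:ℝ) ≤ K := by norm_cast; omega
  induction n with
  | zero =>
    refine ⟨g, by simpa using hg, fun s hs hs' => ?_⟩
    refine Filter.Eventually.filter_mono nhdsWithin_le_nhds ?_
    filter_upwards [isOpen_ball.mem_nhds hs, (isOpen_lt Complex.continuous_re continuous_const).mem_nhds hs'] with t ht ht'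
    exact hgψ t (by simpa using ht) ht'
  | succ n ih =>
    obtain ⟨G, hG, hGψ⟩ := ih
    have hmem : ∀ j < e, ∀ t ∈ ball (0:ℂ) (ε * K ^ (n+1)), 
        (K:ℂ)^j * (((K:ℂ)^e)⁻¹ * t) ∈ ball (0:ℂ) (ε * K ^ n) := by
      intro j hj t ht
      simp only [mem_ball_zero_iff, norm_mul, norm_pow, norm_inv, Complex.norm_natCast] at ht ⊢
      obtain ⟨r, rfl⟩ : ∃ r, e = j + 1 + r := ⟨e - (j+1), by omega⟩
      have h1 : (K:ℝ)^j * (((K:ℝ)^(j+1+r))⁻¹ * ‖t‖) = ‖t‖ / K / K^r := by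
        rw [pow_add, pow_add]; field_simp
      rw [h1]
      refine (div_le_self (by positivity) (one_le_pow₀ hKR1)).trans_lt ?_
      rw [div_lt_iff₀ hKR]
      calc _ < _ := ht
        _ = _ := by ring
    have hCa : ∀ j s, AnalyticAt ℂ (C j) s := fun j s => (hC j).analyticAt s
    refine ⟨fun t => -(∑ j ∈ Finset.range e, C j (((K:ℂ)^e)⁻¹ * t) * G ((K:ℂ)^j * (((K:ℂ)^e)⁻¹ * t)))
      / C e (((K:ℂ)^e)⁻¹ * t), ?_, ?_⟩
    · intro t ht
      refine MeromorphicAt.div (MeromorphicAt.neg (MeromorphicAt.fun_sum fun j hj => MeromorphicAt.mul ?_ ?_)) ?_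
      · exact mero_scale (hCa _ _).meromorphicAt
      · exact mero_scale (f := fun s => G ((K:ℂ)^j * s)) 
          (mero_scale (hG _ (hmem j (Finset.mem_range.1 hj) t ht)))
      · exact mero_scale (hCa _ _).meromorphicAt
    · intro t ht ht'
      have hne : ∀ᶠ u in 𝓝[≠] t, C e (((K:ℂ)^e)⁻¹ * u) ≠ 0 := by
        refine (tendsto_scale (a := ((K:ℂ)^e)⁻¹) (by positivity) t).eventually (p := fun u => C e u ≠ 0) ?_
        rcases (hCa e (((K:ℂ)^e)⁻¹ * t)).eventually_eq_zero_or_eventually_ne_zero with h | h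
        · exfalso
          obtain ⟨s, hs⟩ := hCe
          have := AnalyticOnNhd.eqOn_zero_of_preconnected_of_eventuallyEq_zero (U := univ) 
            (fun z _ => hCa e z) isPreconnected_univ (mem_univ _) h (mem_univ s)
          exact hs this
        · exact h
      have hev : ∀ᶠ u in 𝓝[≠] t, ∀ j ∈ Finset.range e, 
          G ((K:ℂ)^j * (((K:ℂ)^e)⁻¹ * u)) = ψ ((K:ℂ)^j * (((K:ℂ)^e)⁻¹ * u)) := by
        rw [Finset.eventually_all]
        intro j hj
        refine ((tendsto_scale (a := (K:ℂ)^j) (by positivity) _).comp 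
          (tendsto_scale (a := ((K:ℂ)^e)⁻¹) (by positivity) t)).eventually
          (hGψ _ (hmem j (Finset.mem_range.1 hj) t ht) ?_)
        have : (K:ℂ)^j * (((K:ℂ)^e)⁻¹ * t) = (((K:ℝ)^j * ((K:ℝ)^e)⁻¹ : ℝ) : ℂ) * t := by
          push_cast; ring
        rw [this, Complex.re_ofReal_mul]
        exact mul_neg_of_pos_of_neg (by positivity) ht'
      have hre : ∀ᶠ u in 𝓝[≠] t, u.re < 0 := 
        mem_nhdsWithin_of_mem_nhds ((isOpen_lt Complex.continuous_re continuous_const).mem_nhds ht')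
      filter_upwards [hne, hev, hre] with u h1 h2 h3
      rw [Finset.sum_congr rfl fun j hj => by rw [h2 j hj]]
      have h4 := hrel (((K:ℂ)^e)⁻¹ * u) (by
        have : (((K:ℂ)^e)⁻¹ * u) = ((((K:ℝ)^e)⁻¹ : ℝ) : ℂ) * u := by push_cast; ring
        rw [this, Complex.re_ofReal_mul]
        exact mul_neg_of_pos_of_neg (by positivity) h3)
      rw [Finset.sum_range_succ, mul_inv_cancel_left₀ (by positivity)] at h4
      rw [div_eq_iff h1]
      linear_combination -h4

theorem nf_eq {f g : ℂ → ℂ} {x : ℂ} (hf : MeromorphicNFAt f x) (hg : MeromorphicNFAt g x)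
    (h : f =ᶠ[𝓝[≠] x] g) : f =ᶠ[𝓝 x] g :=
  (hf.eventuallyEq_nhdsNE_iff_eventuallyEq_nhds hg).1 h

theorem halfball_conn (r : ℝ) : IsPreconnected (ball (0:ℂ) r) := (convex_ball _ _).isPreconnected

theorem glue (ψ : ℂ → ℂ) (ρ : ℕ → ℝ) (hρ0 : ∀ n, 0 < ρ n) (hρ : Tendsto ρ atTop atTop) (hmono : Monotone ρ)
    (h : ∀ n, ∃ G : ℂ → ℂ, MeromorphicOn G (ball 0 (ρ n)) ∧ 
      ∀ s ∈ ball (0:ℂ) (ρ n), s.re < 0 → G =ᶠ[𝓝[≠] s] ψ) :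
    ∃ Ψ : ℂ → ℂ, (∀ s, MeromorphicNFAt Ψ s) ∧ ∀ s : ℂ, s.re < 0 → Ψ =ᶠ[𝓝[≠] s] ψ := by
  have h' : ∀ n, ∃ G : ℂ → ℂ, MeromorphicNFOn G (ball 0 (ρ n)) ∧ 
      ∀ s ∈ ball (0:ℂ) (ρ n), s.re < 0 → G =ᶠ[𝓝[≠] s] ψ := by
    intro n
    obtain ⟨G, hG, hGψ⟩ := h n
    refine ⟨toMeromorphicNFOn G (ball 0 (ρ n)), meromorphicNFOn_toMeromorphicNFOn _ _, fun s hs hs' => ?_⟩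
    exact (hG.toMeromorphicNFOn_eq_self_on_nhdsNE hs).trans (hGψ s hs hs')
  choose G hG hGψ using h'
  have heq : ∀ m n, m ≤ n → ∀ s ∈ ball (0:ℂ) (ρ m), G m s = G n s := by
    intro m n hmn s hs
    have hsub : ball (0:ℂ) (ρ m) ⊆ ball 0 (ρ n) := ball_subset_ball (hmono hmn)
    set x : ℂ := ((-(ρ m / 2) : ℝ) : ℂ)
    have hx : x ∈ ball (0:ℂ) (ρ m) := by
      simp only [x, mem_ball_zero_iff, Complex.norm_real, Real.norm_eq_abs, abs_neg]
      rw [abs_of_pos (by have := hρ0 m; positivity)]; linarith [hρ0 m]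
    have hx' : x.re < 0 := by simp [x]; exact hρ0 m
    have := mero_ident₂ (hG m).meromorphicOn ((hG n).meromorphicOn.mono_set hsub) (halfball_conn _)
      hx ((hGψ m x hx hx').trans (hGψ n x (hsub hx) hx').symm) hs
    exact (nf_eq (hG m hs) (hG n (hsub hs)) this).eq_of_nhds
  have hex : ∀ s : ℂ, ∃ n, s ∈ ball (0:ℂ) (ρ n) := fun s => by
    obtain ⟨n, hn⟩ := (hρ.eventually_gt_atTop ‖s‖).exists
    exact ⟨n, by simpa using hn⟩
  choose N hN using hex
  have hloc : ∀ n, ∀ s ∈ ball (0:ℂ) (ρ n), (fun s => G (N s) s) =ᶠ[𝓝 s] G n := by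
    intro n s hs
    filter_upwards [isOpen_ball.mem_nhds hs] with t ht
    rcases le_total (N t) n with h | h
    · exact heq _ _ h t (hN t)
    · exact (heq _ _ h t ht).symm
  refine ⟨fun s => G (N s) s, fun s => ?_, fun s hs => ?_⟩
  · exact (meromorphicNFAt_congr (hloc _ s (hN s))).2 (hG _ (hN s))
  · exact ((hloc _ s (hN s)).filter_mono nhdsWithin_le_nhds).trans (hGψ _ s (hN s) hs)

theorem extend_all (K e : ℕ) (hK : 2 ≤ K) (he : 1 ≤ e) (C : ℕ → ℂ → ℂ) (hC : ∀ j, Differentiable ℂ (C j))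
    (hCe : ∃ s, C e s ≠ 0) (ψ : ℂ → ℂ)
    (hper : ∀ s : ℂ, ψ (s + 2 * Real.pi * Complex.I) = ψ s)
    (hrel : ∀ s : ℂ, s.re < 0 → ∑ j ∈ Finset.range (e+1), C j s * ψ ((K:ℂ) ^ j * s) = 0)
    (ε : ℝ) (hε : 0 < ε) (g : ℂ → ℂ) (hg : MeromorphicOn g (ball 0 ε))
    (hgψ : ∀ s ∈ ball (0:ℂ) ε, s.re < 0 → g s = ψ s) :
    ∃ Ψ : ℂ → ℂ, (∀ s, MeromorphicNFAt Ψ s) ∧ (∀ s : ℂ, s.re < 0 → Ψ =ᶠ[𝓝[≠] s] ψ) ∧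
      (∀ s : ℂ, Ψ (s + 2 * Real.pi * Complex.I) = Ψ s) ∧
      ∀ s, ∀ᶠ t in 𝓝[≠] s, ∑ j ∈ Finset.range (e+1), C j t * Ψ ((K:ℂ) ^ j * t) = 0 := by
  have hK0 : (K:ℂ) ≠ 0 := by norm_cast; omega
  have hKR : (0:ℝ) < K := by norm_cast; omega
  have hKR1 : (1:ℝ) < K := by norm_cast
  obtain ⟨Ψ, hNF, hΨ⟩ := glue ψ (fun n => ε * K ^ n) (fun n => by positivity) 
    ((tendsto_pow_atTop_atTop_of_one_lt hKR1).const_mul_atTop hε)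
    (fun m n hmn => by
      have := pow_le_pow_right₀ hKR1.le hmn
      simp only; gcongr)
    (extend_ball K e hK he C hC hCe ψ hrel ε hε g hg hgψ)
  have hre : ∀ᶠ u : ℂ in 𝓝[≠] (-1), u.re < 0 := 
    mem_nhdsWithin_of_mem_nhds ((isOpen_lt Complex.continuous_re continuous_const).mem_nhds (by simp))
  refine ⟨Ψ, hNF, hΨ, ?_, ?_⟩
  · intro s
    have hNF' : ∀ s, MeromorphicNFAt (fun s => Ψ (s + 2 * Real.pi * Complex.I)) s := fun s =>
      meromorphicNFAt_comp_add_const_iff_meromorphicNFAt.2 (hNF _)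
    have h1 : (fun s => Ψ (s + 2 * Real.pi * Complex.I)) =ᶠ[𝓝[≠] (-1)] Ψ := by
      have ht : Tendsto (fun s : ℂ => s + 2 * Real.pi * Complex.I) (𝓝[≠] (-1)) (𝓝[≠] (-1 + 2 * Real.pi * Complex.I)) := by
        refine tendsto_nhdsWithin_of_tendsto_nhds_of_eventually_within _ 
          (Continuous.tendsto (by fun_prop) _ |>.mono_left nhdsWithin_le_nhds) ?_
        filter_upwards [self_mem_nhdsWithin] with t ht
        simpa using ht
      filter_upwards [ht.eventually (hΨ (-1 + 2 * Real.pi * Complex.I) (by simp)), hΨ (-1) (by simp)] with t h1 h2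
      rw [h1, h2, hper]
    have h2 := mero_ident₂ (U := univ) (fun z _ => (hNF' z).meromorphicAt) (fun z _ => (hNF z).meromorphicAt)
      isPreconnected_univ (mem_univ _) h1 (mem_univ s)
    exact (nf_eq (hNF' s) (hNF s) h2).eq_of_nhds
  · intro s
    refine mero_ident (U := univ) (x := -1) (f := fun t => ∑ j ∈ Finset.range (e+1), C j t * Ψ ((K:ℂ) ^ j * t))
      (fun z _ => MeromorphicAt.fun_sum fun j _ => MeromorphicAt.mul ((hC j).analyticAt z).meromorphicAt 
        (mero_scale (hNF _).meromorphicAt)) isPreconnected_univ (mem_univ _) ?_ (mem_univ s)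
    have hev : ∀ᶠ u in 𝓝[≠] (-1 : ℂ), ∀ j ∈ Finset.range (e+1), Ψ ((K:ℂ)^j * u) = ψ ((K:ℂ)^j * u) := by
      rw [Finset.eventually_all]
      intro j hj
      refine (tendsto_scale (a := (K:ℂ)^j) (by positivity) _).eventually (hΨ _ ?_)
      have : (K:ℂ)^j * (-1) = ((-(K:ℝ)^j : ℝ) : ℂ) := by push_cast; ring
      rw [this, Complex.ofReal_re]
      have : (0:ℝ) < (K:ℝ)^j := by positivity
      linarith
    filter_upwards [hev, hre] with u h1 h2
    rw [Finset.sum_congr rfl fun j hj => by rw [h1 j hj]]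
    exact hrel u h2

theorem nf_analytic {f g : ℂ → ℂ} {x : ℂ} (hf : MeromorphicNFAt f x) (hg : AnalyticAt ℂ g x)
    (h : f =ᶠ[𝓝[≠] x] g) : AnalyticAt ℂ f x :=
  hg.congr (nf_eq hf hg.meromorphicNFAt h).symm

theorem analytic_scale {f : ℂ → ℂ} {a x : ℂ} (h : AnalyticAt ℂ f (a * x)) :
    AnalyticAt ℂ (fun t => f (a * t)) x :=
  AnalyticAt.comp (g := f) (f := fun t => a * t) h (by fun_prop)

section
variable (K e : ℕ) (hK : 2 ≤ K) (he : 1 ≤ e) (C : ℕ → ℂ → ℂ) (hC : ∀ j, Differentiable ℂ (C j))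
    (Ψ : ℂ → ℂ) (hNF : ∀ s, MeromorphicNFAt Ψ s)
    (hper : ∀ s : ℂ, Ψ (s + 2 * Real.pi * Complex.I) = Ψ s)
    (hrel : ∀ s, ∀ᶠ t in 𝓝[≠] s, ∑ j ∈ Finset.range (e+1), C j t * Ψ ((K:ℂ) ^ j * t) = 0)
    (c : ℝ) (hc : 0 < c) (hC0 : ∀ s : ℂ, c < s.re → C 0 s ≠ 0) (hCe : ∀ s : ℂ, c < s.re → C e s ≠ 0)

theorem pole_fwd (hC : ∀ j, Differentiable ℂ (C j))
    (hNF : ∀ s, MeromorphicNFAt Ψ s)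
    (hrel : ∀ s, ∀ᶠ t in 𝓝[≠] s, ∑ j ∈ Finset.range (e+1), C j t * Ψ ((K:ℂ) ^ j * t) = 0)
    (hC0 : ∀ s : ℂ, c < s.re → C 0 s ≠ 0) (p : ℂ) (hp : c < p.re)
    (h : ∀ j, 1 ≤ j → j ≤ e → AnalyticAt ℂ Ψ ((K:ℂ) ^ j * p)) : AnalyticAt ℂ Ψ p := by
  have hCa : ∀ j s, AnalyticAt ℂ (C j) s := fun j s => (hC j).analyticAt s
  refine nf_analytic (hNF p) (g := fun t => -(∑ j ∈ Finset.range e, C (j+1) t * Ψ ((K:ℂ)^(j+1) * t)) / C 0 t) ?_ ?_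
  · refine AnalyticAt.div (AnalyticAt.neg (Finset.analyticAt_fun_sum _ fun j hj => (hCa _ _).mul ?_)) (hCa _ _) (hC0 p hp)
    exact analytic_scale (h _ (by omega) (by simp at hj; omega))
  · have hne : ∀ᶠ t in 𝓝[≠] p, C 0 t ≠ 0 := 
      ((hCa 0 p).continuousAt.eventually_ne (hC0 p hp)).filter_mono nhdsWithin_le_nhds
    filter_upwards [hne, hrel p] with t h1 h2
    rw [Finset.sum_range_succ'] at h2
    simp only [pow_zero, one_mul] at h2
    rw [eq_div_iff h1]
    linear_combination h2

theorem pole_bwd (hK : 2 ≤ K) (hC : ∀ j, Differentiable ℂ (C j))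
    (hNF : ∀ s, MeromorphicNFAt Ψ s)
    (hrel : ∀ s, ∀ᶠ t in 𝓝[≠] s, ∑ j ∈ Finset.range (e+1), C j t * Ψ ((K:ℂ) ^ j * t) = 0)
    (hCe : ∀ s : ℂ, c < s.re → C e s ≠ 0) (q : ℂ) (hq : c * K ^ e < q.re)
    (h : ∀ l, 1 ≤ l → l ≤ e → AnalyticAt ℂ Ψ (q / (K:ℂ) ^ l)) : AnalyticAt ℂ Ψ q := by
  have hCa : ∀ j s, AnalyticAt ℂ (C j) s := fun j s => (hC j).analyticAt s
  have hK0 : (K:ℂ) ≠ 0 := by norm_cast; omega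
  have hKR : (0:ℝ) < K := by norm_cast; omega
  have hre : c < (((K:ℂ)^e)⁻¹ * q).re := by
    have : (((K:ℂ)^e)⁻¹ * q) = ((((K:ℝ)^e)⁻¹ : ℝ) : ℂ) * q := by push_cast; ring
    rw [this, Complex.re_ofReal_mul, inv_mul_eq_div, lt_div_iff₀ (by positivity)]
    exact hq
  have hKe : ((K:ℂ)^e)⁻¹ ≠ 0 := inv_ne_zero (pow_ne_zero _ hK0)
  refine nf_analytic (hNF q) (g := fun t => -(∑ j ∈ Finset.range e, C j (((K:ℂ)^e)⁻¹ * t) * Ψ ((K:ℂ)^j * (((K:ℂ)^e)⁻¹ * t)))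
      / C e (((K:ℂ)^e)⁻¹ * t)) ?_ ?_
  · refine AnalyticAt.div (AnalyticAt.neg (Finset.analyticAt_fun_sum _ fun j hj => AnalyticAt.mul ?_ ?_)) ?_ (hCe _ hre)
    · exact analytic_scale (hCa _ _)
    · refine analytic_scale (f := fun s => Ψ ((K:ℂ)^j * s)) (analytic_scale ?_)
      simp at hj
      have := h (e - j) (by omega) (by omega)
      convert this using 1
      obtain ⟨r, rfl⟩ : ∃ r, e = j + r := ⟨e - j, by omega⟩
      rw [Nat.add_sub_cancel_left, pow_add]; field_simp
    · exact analytic_scale (hCa _ _)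
  · have hne : ∀ᶠ t in 𝓝[≠] q, C e (((K:ℂ)^e)⁻¹ * t) ≠ 0 := 
      ((analytic_scale (hCa e _)).continuousAt.eventually_ne (hCe _ hre)).filter_mono nhdsWithin_le_nhds
    filter_upwards [hne, (tendsto_scale hKe q).eventually (hrel _)] with t h1 h2
    rw [Finset.sum_range_succ, mul_inv_cancel_left₀ (pow_ne_zero _ hK0)] at h2
    rw [eq_div_iff h1]
    linear_combination h2

theorem analytic_right (hK : 2 ≤ K) (he : 1 ≤ e) (hC : ∀ j, Differentiable ℂ (C j))
    (hNF : ∀ s, MeromorphicNFAt Ψ s)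
    (hper : ∀ s : ℂ, Ψ (s + 2 * Real.pi * Complex.I) = Ψ s)
    (hrel : ∀ s, ∀ᶠ t in 𝓝[≠] s, ∑ j ∈ Finset.range (e+1), C j t * Ψ ((K:ℂ) ^ j * t) = 0)
    (hc : 0 < c) (hC0 : ∀ s : ℂ, c < s.re → C 0 s ≠ 0) (hCe : ∀ s : ℂ, c < s.re → C e s ≠ 0)
    (p : ℂ) (hp : c * K ^ e < p.re) : AnalyticAt ℂ Ψ p := by
  have hK0 : (K:ℂ) ≠ 0 := by norm_cast; omega
  have hKR : (0:ℝ) < K := by norm_cast; omega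
  have hKR1 : (1:ℝ) < K := by norm_cast
  by_contra hpole
  have hre : ∀ n, ((K:ℂ)^n * p).re = (K:ℝ)^n * p.re := fun n => by
    rw [← Complex.re_ofReal_mul]; push_cast; rfl
  have hpc : c < p.re := lt_of_le_of_lt (le_mul_of_one_le_right hc.le (one_le_pow₀ hKR1.le)) hp
  have hA : ∀ N : ℕ, ∃ n ≥ N, ¬ AnalyticAt ℂ Ψ ((K:ℂ)^n * p) := by
    intro N
    induction N with
    | zero => exact ⟨0, le_rfl, by simpa using hpole⟩
    | succ N ih =>
      obtain ⟨n, hn, hn'⟩ := ih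
      by_contra! hcon
      refine hn' (pole_fwd K e C Ψ c hC hNF hrel hC0 _ ?_ fun j hj hj' => ?_)
      · rw [hre]
        exact hpc.trans_le (le_mul_of_one_le_left (hc.trans hpc).le (one_le_pow₀ hKR1.le))
      · rw [← mul_assoc, ← pow_add]
        exact hcon _ (by omega)
  have hB : ∀ (q : ℂ) (n : ℕ), ¬ AnalyticAt ℂ Ψ q → c * K ^ (n + e) < q.re → 
      ∃ l, n ≤ l ∧ l < n + e ∧ ¬ AnalyticAt ℂ Ψ (q / (K:ℂ)^l) := by
    intro q n hq
    induction n with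
    | zero => intro _; exact ⟨0, le_rfl, by omega, by simpa using hq⟩
    | succ n ih =>
      intro hqr
      have hqr' : c * K ^ (n + e) < q.re := by
        refine lt_of_le_of_lt ?_ hqr
        gcongr
        · exact hKR1.le
        · omega
      obtain ⟨l, hl, hl', hpo⟩ := ih hqr'
      rcases Nat.lt_or_ge n l with h | h
      · exact ⟨l, h, by omega, hpo⟩
      · obtain rfl : l = n := le_antisymm h hl
        by_contra! hcon
        refine hpo (pole_bwd K e C Ψ c hK hC hNF hrel hCe _ ?_ fun i hi hi' => ?_)
        · have : q / (K:ℂ)^l = (((((K:ℝ)^l)⁻¹ : ℝ)) : ℂ) * q := by push_cast; field_simp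
          rw [this, Complex.re_ofReal_mul, inv_mul_eq_div, lt_div_iff₀ (by positivity)]
          calc _ = c * K ^ (l + e) := by ring
            _ < _ := hqr'
        · rw [div_div, ← pow_add]
          exact hcon (l + i) (by omega) (by omega)
  have hper' : ∀ s, AnalyticAt ℂ Ψ (s + 2 * Real.pi * Complex.I) → AnalyticAt ℂ Ψ s := by
    intro s hs
    have : AnalyticAt ℂ (fun t => Ψ (t + 2 * Real.pi * Complex.I)) s := 
      AnalyticAt.comp (g := Ψ) (f := fun t => t + 2 * Real.pi * Complex.I) hs (by fun_prop)
    exact this.congr (Eventually.of_forall hper)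
  have hev : ∀ᶠ l : ℕ in atTop, ∀ i ∈ Finset.range e, 
      AnalyticAt ℂ Ψ (p / (K:ℂ)^i + 2 * Real.pi * Complex.I / (K:ℂ)^l) := by
    rw [Finset.eventually_all]
    intro i _
    have ht : Tendsto (fun l : ℕ => p / (K:ℂ)^i + 2 * Real.pi * Complex.I / (K:ℂ)^l) atTop (𝓝[≠] (p / (K:ℂ)^i)) := by
      refine tendsto_nhdsWithin_of_tendsto_nhds_of_eventually_within _ ?_ (Eventually.of_forall fun l => ?_)
      · have h0 : Tendsto (fun l : ℕ => ((K:ℂ)⁻¹)^l) atTop (𝓝 0) := by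
          refine tendsto_pow_atTop_nhds_zero_of_norm_lt_one ?_
          rw [norm_inv, Complex.norm_natCast]
          exact inv_lt_one_of_one_lt₀ hKR1
        have := (h0.const_mul (2 * Real.pi * Complex.I)).const_add (p / (K:ℂ)^i)
        simpa [div_eq_mul_inv] using this
      · have : (2 * Real.pi * Complex.I / (K:ℂ)^l) ≠ 0 := 
          div_ne_zero Complex.two_pi_I_ne_zero (pow_ne_zero _ hK0)
        simpa using this
    exact ht.eventually (hNF _).meromorphicAt.eventually_analyticAt
  obtain ⟨N, hN⟩ := eventually_atTop.1 hev
  obtain ⟨n, hn, hnp⟩ := hA N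
  obtain ⟨l, hl, hl', hlp⟩ := hB ((K:ℂ)^n * p + 2 * Real.pi * Complex.I) n (fun h => hnp (hper' _ h)) (by
    rw [Complex.add_re, hre]
    have : (2 * (Real.pi:ℂ) * Complex.I).re = 0 := by simp
    rw [this, add_zero, pow_add]
    calc c * (K^n * K^e) = K^n * (c * K^e) := by ring
      _ < _ := by gcongr)
  apply hlp
  have := hN l (by omega) (l - n) (by simp; omega)
  convert this using 1
  obtain ⟨r, rfl⟩ : ∃ r, l = n + r := ⟨l - n, by omega⟩
  rw [Nat.add_sub_cancel_left, add_div]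
  congr 1
  rw [pow_add]; field_simp

theorem growth (hK : 2 ≤ K) (hC : ∀ j, Differentiable ℂ (C j))
    (hper : ∀ s : ℂ, Ψ (s + 2 * Real.pi * Complex.I) = Ψ s)
    (hrel : ∀ s, ∀ᶠ t in 𝓝[≠] s, ∑ j ∈ Finset.range (e+1), C j t * Ψ ((K:ℂ) ^ j * t) = 0)
    (c B m δ : ℝ) (hc : 1 ≤ c) (hδ : 0 < δ) (hB : 0 ≤ B) (hm : 0 ≤ m) 
    (han : ∀ s : ℂ, c ≤ s.re → AnalyticAt ℂ Ψ s)
    (hCB : ∀ j ≤ e, ∀ s : ℂ, c ≤ s.re → ‖C j s‖ ≤ B * Real.exp (m * s.re))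
    (hCδ : ∀ s : ℂ, c ≤ s.re → δ ≤ ‖C e s‖) :
    ∃ M L : ℝ, ∀ s : ℂ, c ≤ s.re → ‖Ψ s‖ ≤ M * Real.exp (L * s.re) := by
  have hK0 : (K:ℂ) ≠ 0 := by norm_cast; omega
  have hKR : (0:ℝ) < K := by norm_cast; omega
  have hKR1 : (1:ℝ) < K := by norm_cast
  have hK2 : (2:ℝ) ≤ K := by norm_cast
  have hex : ∀ s : ℂ, c ≤ s.re → ∑ j ∈ Finset.range (e+1), C j s * Ψ ((K:ℂ) ^ j * s) = 0 := by
    intro s hs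
    have ha : AnalyticAt ℂ (fun t => ∑ j ∈ Finset.range (e+1), C j t * Ψ ((K:ℂ) ^ j * t)) s := by
      refine Finset.analyticAt_fun_sum _ fun j _ => ((hC j).analyticAt s).mul (analytic_scale (han _ ?_))
      have : (K:ℂ)^j * s = (((K:ℝ)^j : ℝ) : ℂ) * s := by push_cast; rfl
      rw [this, Complex.re_ofReal_mul]
      exact hs.trans (le_mul_of_one_le_left (by linarith) (one_le_pow₀ hKR1.le))
    exact (nf_eq ha.meromorphicNFAt analyticAt_const.meromorphicNFAt (hrel s)).eq_of_nhds
  obtain ⟨M, hM0, hM⟩ : ∃ M : ℝ, 0 ≤ M ∧ ∀ s : ℂ, c ≤ s.re → s.re ≤ c * K ^ e → ‖Ψ s‖ ≤ M := by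
    have hcomp : IsCompact (Icc c (c * K^e) ×ℂ Icc (0:ℝ) (2 * Real.pi)) := isCompact_Icc.reProdIm isCompact_Icc
    obtain ⟨M, hM⟩ := hcomp.exists_bound_of_continuousOn (f := Ψ) (fun s hs =>
      (han s (Complex.mem_reProdIm.1 hs).1.1).continuousAt.continuousWithinAt)
    refine ⟨max M 0, le_max_right _ _, fun s h1 h2 => le_max_of_le_left ?_⟩
    have hp : Function.Periodic Ψ (2 * Real.pi * Complex.I) := hper
    obtain ⟨y, hy, n, hn⟩ : ∃ y ∈ Ico (0:ℝ) (0 + 2 * Real.pi), ∃ n : ℤ, s.im - n • (2 * Real.pi) = y :=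
      ⟨_, toIcoMod_mem_Ico Real.two_pi_pos 0 s.im, toIcoDiv Real.two_pi_pos 0 s.im, rfl⟩
    rw [← hp.sub_zsmul_eq n]
    have him : (s - n • (2 * (Real.pi:ℂ) * Complex.I)).im = y := by
      rw [← hn]; simp
    have hre : (s - n • (2 * (Real.pi:ℂ) * Complex.I)).re = s.re := by simp
    refine hM _ (Complex.mem_reProdIm.2 ⟨?_, ?_⟩)
    · rw [hre]; exact ⟨h1, h2⟩
    · rw [him]; exact ⟨hy.1, by linarith [hy.2]⟩
  set A := e * B / δ with hA
  have hA0 : 0 ≤ A := by positivity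
  set L := m + 2 * A with hL
  have hL0 : 0 ≤ L := by positivity
  refine ⟨M, L, ?_⟩
  have key : ∀ n : ℕ, ∀ s : ℂ, c ≤ s.re → s.re ≤ c * K ^ e * K ^ n → ‖Ψ s‖ ≤ M * Real.exp (L * s.re) := by
    intro n
    induction n with
    | zero =>
      intro s h1 h2
      refine (hM s h1 (by simpa using h2)).trans (le_mul_of_one_le_right hM0 (Real.one_le_exp ?_))
      have : 0 ≤ s.re := by linarith
      positivity
    | succ n ih =>
      intro t h1 h2
      rcases le_or_gt t.re (c * K^e) with h | h
      · refine (hM t h1 h).trans (le_mul_of_one_le_right hM0 (Real.one_le_exp ?_))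
        have : 0 ≤ t.re := by linarith
        positivity
      · set s := ((K:ℂ)^e)⁻¹ * t with hs
        have ht0 : 0 ≤ t.re := by linarith
        have hsre : s.re = t.re / K^e := by
          have : s = ((((K:ℝ)^e)⁻¹ : ℝ) : ℂ) * t := by rw [hs]; push_cast; ring
          rw [this, Complex.re_ofReal_mul, inv_mul_eq_div]
        have hcs : c ≤ s.re := by rw [hsre, le_div_iff₀ (by positivity)]; exact h.le
        have hrel := hex s hcs
        rw [Finset.sum_range_succ, hs, mul_inv_cancel_left₀ (pow_ne_zero _ hK0), ← hs] at hrel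
        have hterm : ∀ j ∈ Finset.range e, ‖C j s * Ψ ((K:ℂ)^j * s)‖ ≤ B * Real.exp (m * (t.re/2)) * (M * Real.exp (L * (t.re / 2))) := by
          intro j hj
          simp only [Finset.mem_range] at hj
          obtain ⟨r, hr⟩ : ∃ r, e = j + 1 + r := ⟨e - (j+1), by omega⟩
          have hjre : ((K:ℂ)^j * s).re = t.re / K / K^r := by
            have : (K:ℂ)^j * s = (((K:ℝ)^j : ℝ) : ℂ) * s := by push_cast; rfl
            rw [this, Complex.re_ofReal_mul, hsre, hr, pow_add, pow_add]; field_simp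
          have hle1 : ((K:ℂ)^j * s).re ≤ t.re / K := by
            rw [hjre]; exact div_le_self (by positivity) (one_le_pow₀ hKR1.le)
          have hle2 : t.re / K ≤ t.re / 2 := by gcongr
          have hge : s.re ≤ ((K:ℂ)^j * s).re := by
            have : (K:ℂ)^j * s = (((K:ℝ)^j : ℝ) : ℂ) * s := by push_cast; rfl
            rw [this, Complex.re_ofReal_mul]
            exact le_mul_of_one_le_left (by linarith) (one_le_pow₀ hKR1.le)
          rw [norm_mul]
          have b1 := hCB j (by omega) s hcs
          have b2 := ih ((K:ℂ)^j * s) (hcs.trans hge) (hle1.trans (by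
            rw [div_le_iff₀ hKR]
            calc _ ≤ _ := h2
              _ = _ := by ring))
          have b3 : s.re ≤ t.re / 2 := by linarith
          have b4 : ((K:ℂ)^j * s).re ≤ t.re / 2 := by linarith
          refine mul_le_mul (b1.trans ?_) (b2.trans ?_) (norm_nonneg _) (by positivity)
          · gcongr
          · gcongr
        have hnorm : ‖C e s‖ * ‖Ψ t‖ ≤ e * (B * Real.exp (m * (t.re/2)) * (M * Real.exp (L * (t.re / 2)))) := by
          rw [← norm_mul, eq_neg_of_add_eq_zero_right hrel, norm_neg]
          refine (norm_sum_le_of_le _ hterm).trans ?_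
          simp
        have h3 : δ * ‖Ψ t‖ ≤ e * (B * Real.exp (m * (t.re/2)) * (M * Real.exp (L * (t.re / 2)))) :=
          (mul_le_mul_of_nonneg_right (hCδ s hcs) (norm_nonneg _)).trans hnorm
        have h4 : ‖Ψ t‖ ≤ A * Real.exp (m * (t.re/2)) * (M * Real.exp (L * (t.re / 2))) := by
          rw [← le_div_iff₀' hδ] at h3
          refine h3.trans (le_of_eq ?_)
          rw [hA]; ring
        have h5 : A ≤ Real.exp (A * t.re) := by
          have : A + 1 ≤ Real.exp A := Real.add_one_le_exp A
          have h6 : Real.exp A ≤ Real.exp (A * t.re) := by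
            gcongr; exact le_mul_of_one_le_right hA0 (by linarith)
          linarith
        calc ‖Ψ t‖ ≤ _ := h4
          _ ≤ Real.exp (A * t.re) * Real.exp (m * (t.re/2)) * (M * Real.exp (L * (t.re / 2))) := by gcongr
          _ = M * (Real.exp (A * t.re) * Real.exp (m * (t.re/2)) * Real.exp (L * (t.re / 2))) := by ring
          _ = _ := by
            rw [← Real.exp_add, ← Real.exp_add, hL]; congr 2; ring
  intro s hs
  obtain ⟨n, hn⟩ := ((tendsto_pow_atTop_atTop_of_one_lt hKR1).eventually_ge_atTop s.re).exists
  refine key n s hs (hn.trans ?_)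
  refine le_mul_of_one_le_left (by positivity) ?_
  exact one_le_mul_of_one_le_of_one_le hc (one_le_pow₀ hKR1.le)
end

theorem final_aux (K e i : ℕ) (hK : 2 ≤ K) (he : 1 ≤ e) (P : ℕ → ℂ[X]) (hP0 : P 0 ≠ 0) (hPe : P e ≠ 0)
    (f : ℂ → ℂ) (hf0 : AnalyticAt ℂ f 0)
    (hrel : ∀ z ∈ ball (0 : ℂ) 1, ∑ j ∈ Finset.range (e + 1), (P j).eval z * f (z ^ K ^ (i + j)) = 0)
    (w : ℂ) (hw : ‖w‖ = 1) (hwK : w ^ K = w) (U : Set ℂ) (hU : IsOpen U) (hwU : w ∈ U) (g : ℂ → ℂ)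
    (hg : AnalyticOnNhd ℂ g U) (hfg : EqOn f g (U ∩ ball (0 : ℂ) 1)) :
    ∃ P Q : ℂ[X], Q ≠ 0 ∧ ∀ z ∈ ball (0 : ℂ) 1, AnalyticAt ℂ f z → f z * Q.eval z = P.eval z := by
  have hK0 : (K:ℂ) ≠ 0 := by norm_cast; omega
  have hKR : (0:ℝ) < K := by norm_cast; omega
  have hKR1 : (1:ℝ) < K := by norm_cast
  have hw0 : w ≠ 0 := by rintro rfl; simp at hw
  have hwp : ∀ n, w ^ K ^ n = w := by
    intro n
    induction n with
    | zero => simp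
    | succ n ih => rw [pow_succ, pow_mul, ih, hwK]
  have hnorm : ∀ s : ℂ, ‖w * Complex.exp s‖ = Real.exp s.re := fun s => by
    rw [norm_mul, hw, one_mul, Complex.norm_exp]
  set ψ : ℂ → ℂ := fun s => f (w * Complex.exp s) with hψ
  set C : ℕ → ℂ → ℂ := fun j s => (P j).eval (w * Complex.exp (((K:ℂ)^i)⁻¹ * s)) with hCdef
  have hC : ∀ j, Differentiable ℂ (C j) := fun j => 
    (P j).differentiable.comp (g := fun z => (P j).eval z) (f := fun s => w * Complex.exp (((K:ℂ)^i)⁻¹ * s)) (by fun_prop)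
  have hire : ∀ s : ℂ, (((K:ℂ)^i)⁻¹ * s).re = s.re / K^i := fun s => by
    have : ((K:ℂ)^i)⁻¹ * s = ((((K:ℝ)^i)⁻¹ : ℝ) : ℂ) * s := by push_cast; ring
    rw [this, Complex.re_ofReal_mul, inv_mul_eq_div]
  have hper : ∀ s : ℂ, ψ (s + 2 * Real.pi * Complex.I) = ψ s := fun s => by
    simp only [hψ, Complex.exp_add, Complex.exp_two_pi_mul_I, mul_one]
  have hrelψ : ∀ s : ℂ, s.re < 0 → ∑ j ∈ Finset.range (e+1), C j s * ψ ((K:ℂ) ^ j * s) = 0 := by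
    intro s hs
    have := hrel (w * Complex.exp (((K:ℂ)^i)⁻¹ * s)) (by
      rw [mem_ball_zero_iff, hnorm, Real.exp_lt_one_iff, hire]
      exact div_neg_of_neg_of_pos hs (by positivity))
    rw [← this]
    refine Finset.sum_congr rfl fun j _ => ?_
    simp only [hCdef, hψ]
    congr 2
    rw [mul_pow, hwp, ← Complex.exp_nat_mul]
    congr 2
    push_cast
    rw [pow_add]; field_simp
  have hlim : Tendsto (fun s => w * Complex.exp s) (𝓝 0) (𝓝 w) := by
    have : Continuous (fun s => w * Complex.exp s) := by fun_prop
    simpa using this.tendsto 0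
  obtain ⟨ε, hε, hball⟩ := Metric.mem_nhds_iff.1 (hlim (hU.mem_nhds hwU))
  obtain ⟨δ0, R0, hδ0, h0⟩ := poly_lower (P 0) hP0
  obtain ⟨δ, R, hδ, hR⟩ := poly_lower (P e) hPe
  set c : ℝ := max (max R0 R) 1 * K^i with hc
  have hc0 : 0 < c := by positivity
  have hcs : ∀ s : ℂ, c ≤ s.re → max (max R0 R) 1 ≤ ‖w * Complex.exp (((K:ℂ)^i)⁻¹ * s)‖ := by
    intro s hs
    rw [hnorm, hire]
    have h1 : max (max R0 R) 1 ≤ s.re / K^i := by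
      rw [le_div_iff₀ (by positivity)]; exact hs
    have := Real.add_one_le_exp (s.re / K^i)
    linarith
  have hC0' : ∀ s : ℂ, c < s.re → C 0 s ≠ 0 := fun s hs h => by
    have := h0 _ (((le_max_left _ _).trans (le_max_left _ _)).trans (hcs s hs.le))
    simp only [hCdef] at h
    rw [h, norm_zero] at this; linarith
  have hCe' : ∀ s : ℂ, c ≤ s.re → δ ≤ ‖C e s‖ := fun s hs => 
    hR _ (((le_max_right _ _).trans (le_max_left _ _)).trans (hcs s hs))
  have hCe'' : ∀ s : ℂ, c < s.re → C e s ≠ 0 := fun s hs h => by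
    have := hCe' s hs.le
    rw [h, norm_zero] at this; linarith
  obtain ⟨Ψ, hNF, hΨψ, hΨper, hΨrel⟩ := extend_all K e hK he C hC 
    ⟨((c + 1 : ℝ) : ℂ), hCe'' _ (by rw [Complex.ofReal_re]; linarith)⟩ ψ hper hrelψ ε hε
    (fun s => g (w * Complex.exp s)) (fun s hs => by
      have : AnalyticAt ℂ (fun s => g (w * Complex.exp s)) s := 
        AnalyticAt.comp (g := g) (f := fun s => w * Complex.exp s) (hg _ (hball hs)) (by fun_prop)
      exact this.meromorphicAt) (fun s hs hs' => by
      refine (hfg ⟨hball hs, ?_⟩).symm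
      rw [mem_ball_zero_iff, hnorm, Real.exp_lt_one_iff]; exact hs')
  have han := analytic_right K e C Ψ c hK he hC hNF hΨper hΨrel hc0 hC0' hCe''
  choose B m hB hBm using fun j => poly_bound (P j)
  set c1 : ℝ := c * K^e + 1 with hc1
  have hcc1 : c ≤ c1 := by
    have : c ≤ c * K^e := le_mul_of_one_le_right hc0.le (one_le_pow₀ hKR1.le)
    linarith
  obtain ⟨M, L, hML⟩ := growth K e C Ψ hK hC hΨper hΨrel c1 (∑ j ∈ Finset.range (e+1), B j) 
    ((∑ j ∈ Finset.range (e+1), m j : ℕ) : ℝ) δ 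
    (by have : 0 < c * K^e := by positivity
        linarith) hδ (Finset.sum_nonneg fun j _ => hB j) (by positivity)
    (fun s hs => han s (by linarith)) 
    (fun j hj s hs => by
      have hs0 : 0 ≤ s.re := by linarith
      have h1 : 1 ≤ ‖w * Complex.exp (((K:ℂ)^i)⁻¹ * s)‖ := (le_max_right _ _).trans (hcs s (by linarith))
      have hj' : j ∈ Finset.range (e+1) := by simp; omega
      have hmj : m j ≤ ∑ j ∈ Finset.range (e+1), m j := Finset.single_le_sum (fun _ _ => Nat.zero_le _) hj'
      have hBj : B j ≤ ∑ j ∈ Finset.range (e+1), B j := Finset.single_le_sum (fun j _ => hB j) hj'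
      refine (hBm j _ h1).trans (mul_le_mul hBj ?_ (by positivity) ((hB j).trans hBj))
      refine (pow_le_pow_right₀ h1 hmj).trans ?_
      rw [Real.exp_nat_mul, hnorm, hire]
      gcongr
      exact div_le_self hs0 (one_le_pow₀ hKR1.le))
    (fun s hs => hCe' s (by linarith))
  -- descend
  classical
  set Φ : ℂ → ℂ := fun z => if z = 0 then f 0 else Ψ (Complex.log (z / w)) with hΦ
  have hΨp : Function.Periodic Ψ (2 * Real.pi * Complex.I) := hΨper
  have hexp : ∀ z : ℂ, z ≠ 0 → w * Complex.exp (Complex.log (z / w)) = z := fun z hz => by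
    rw [Complex.exp_log (div_ne_zero hz hw0)]; field_simp
  have hlre : ∀ z : ℂ, (Complex.log (z / w)).re = Real.log ‖z‖ := fun z => by
    rw [Complex.log_re, norm_div, hw, div_one]
  have hpexp : ∀ s t : ℂ, Complex.exp s = Complex.exp t → Ψ s = Ψ t := by
    intro s t h
    obtain ⟨n, hn⟩ := Complex.exp_eq_exp_iff_exists_int.1 h
    rw [hn, ← zsmul_eq_mul]
    exact hΨp.zsmul n t
  have hloc : ∀ z₁ : ℂ, z₁ ≠ 0 → Φ =ᶠ[𝓝 z₁] fun z => Ψ (Complex.log (z₁ / w) + Complex.log (z / z₁)) := by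
    intro z₁ hz₁
    filter_upwards [isOpen_ne.mem_nhds hz₁] with z hz
    simp only [hΦ, if_neg hz]
    apply hpexp
    rw [Complex.exp_add, Complex.exp_log (div_ne_zero hz hw0), Complex.exp_log (div_ne_zero hz hz₁),
      Complex.exp_log (div_ne_zero hz₁ hw0)]
    field_simp
  have hbr : ∀ z₁ : ℂ, z₁ ≠ 0 → AnalyticAt ℂ (fun z => Complex.log (z₁ / w) + Complex.log (z / z₁)) z₁ := by
    intro z₁ hz₁
    refine analyticAt_const.add (AnalyticAt.clog (analyticAt_id.div analyticAt_const hz₁) ?_)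
    simp [hz₁]
  have hbr1 : ∀ z₁ : ℂ, z₁ ≠ 0 → Complex.log (z₁ / w) + Complex.log (z₁ / z₁) = Complex.log (z₁ / w) := by
    intro z₁ hz₁; rw [div_self hz₁, Complex.log_one, add_zero]
  have hΦf : ∀ z ∈ ball (0:ℂ) 1, AnalyticAt ℂ f z → Φ z = f z := by
    intro z hz hfz
    by_cases hz0 : z = 0
    · simp [hΦ, hz0]
    · simp only [hΦ, if_neg hz0]
      have hre : (Complex.log (z / w)).re < 0 := by
        rw [hlre]; exact Real.log_neg (norm_pos_iff.2 hz0) (by simpa using hz)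
      have hψa : AnalyticAt ℂ ψ (Complex.log (z / w)) := 
        AnalyticAt.comp (g := f) (f := fun s => w * Complex.exp s) (by rw [hexp z hz0]; exact hfz) (by fun_prop)
      rw [(nf_eq (hNF _) hψa.meromorphicNFAt (hΨψ _ hre)).eq_of_nhds]
      simp only [hψ]
      rw [hexp z hz0]
  have hm : ∀ z, MeromorphicAt Φ z := by
    intro z
    by_cases hz : z = 0
    · subst hz
      have : f =ᶠ[𝓝 0] Φ := by
        filter_upwards [hf0.eventually_analyticAt, isOpen_ball.mem_nhds (mem_ball_self (x := (0:ℂ)) one_pos)] with z h1 h2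
        exact (hΦf z h2 h1).symm
      exact (hf0.congr this).meromorphicAt
    · refine MeromorphicAt.congr ?_ ((hloc z hz).symm.filter_mono nhdsWithin_le_nhds)
      exact MeromorphicAt.comp_analyticAt (f := Ψ) (g := fun y => Complex.log (z / w) + Complex.log (y / z)) 
        (hNF _).meromorphicAt (hbr z hz)
  have hRe : ∀ z : ℂ, Real.exp c1 ≤ ‖z‖ → z ≠ 0 ∧ c1 ≤ (Complex.log (z / w)).re := by
    intro z hz
    have hz0 : 0 < ‖z‖ := (Real.exp_pos _).trans_le hz
    refine ⟨norm_pos_iff.1 hz0, ?_⟩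
    rw [hlre, Real.le_log_iff_exp_le hz0]; exact hz
  have hM0 : 0 ≤ M := by
    have := (norm_nonneg _).trans (hML (c1:ℂ) (by simp))
    exact nonneg_of_mul_nonneg_left this (Real.exp_pos _)
  obtain ⟨P', Q, hQ, hPQ⟩ := rational_of_mero Φ hm (Real.exp c1) M ⌈L⌉₊ (by
    intro z hz
    obtain ⟨hz0, hz1⟩ := hRe z hz
    refine AnalyticAt.congr ?_ (hloc z hz0).symm
    refine AnalyticAt.comp (g := Ψ) (f := fun y => Complex.log (z / w) + Complex.log (y / z)) ?_ (hbr z hz0)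
    rw [hbr1 z hz0]
    exact han _ (by linarith)) (by
    intro z hz
    obtain ⟨hz0, hz1⟩ := hRe z hz
    simp only [hΦ, if_neg hz0]
    refine (hML _ hz1).trans ?_
    gcongr
    rw [hlre, ← Real.exp_log (norm_pos_iff.2 hz0), ← Real.exp_nat_mul, Real.log_exp]
    rw [hlre] at hz1
    have : 0 < c * K^e := by positivity
    gcongr
    · linarith
    · exact Nat.le_ceil L)
  exact ⟨P', Q, hQ, fun z hz hfz => by rw [← hΦf z hz hfz]; exact hPQ z⟩

end Aux

/-- Randé's theorem: a `k`-Mahler function is either rational, or it has the unit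
circle as a natural boundary. Here `f : ℂ → ℂ` is analytic at `0`, meromorphic on the
open unit disk, and satisfies the Mahler functional equation there; the conclusion is
that either `f` agrees with a rational function on the disk, or `f` cannot be
analytically continued past any point of the unit circle. -/
theorem kMahler_rational_or_natural_boundary
    (k : ℕ) (hk : 2 ≤ k) (d : ℕ) (a : ℕ → Polynomial ℂ) (ha : a 0 * a d ≠ 0)
    (f : ℂ → ℂ) (hf0 : AnalyticAt ℂ f 0)
    (hmero : MeromorphicOn f (ball (0 : ℂ) 1))
    (heq : ∀ z ∈ ball (0 : ℂ) 1,
      ∑ j ∈ Finset.range (d + 1), (a j).eval z * f (z ^ k ^ j) = 0) :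
    (∃ P Q : Polynomial ℂ, Q ≠ 0 ∧ ∀ z ∈ ball (0 : ℂ) 1, AnalyticAt ℂ f z →
        f z * Q.eval z = P.eval z) ∨
    (∀ z₀ : ℂ, ‖z₀‖ = 1 →
      ¬ ∃ (U : Set ℂ) (g : ℂ → ℂ), IsOpen U ∧ z₀ ∈ U ∧ AnalyticOnNhd ℂ g U ∧
          EqOn f g (U ∩ ball (0 : ℂ) 1)) := by
  by_cases hnb : ∀ z₀ : ℂ, ‖z₀‖ = 1 →
      ¬ ∃ (U : Set ℂ) (g : ℂ → ℂ), IsOpen U ∧ z₀ ∈ U ∧ AnalyticOnNhd ℂ g U ∧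
          EqOn f g (U ∩ ball (0 : ℂ) 1)
  · exact Or.inr hnb
  · left
    push Not at hnb
    obtain ⟨z₀, hz₀, U, g, hU, hzU, hg, hfg⟩ := hnb
    have ha0 : a 0 ≠ 0 := left_ne_zero_of_mul ha
    have had : a d ≠ 0 := right_ne_zero_of_mul ha
    rcases Nat.eq_zero_or_pos d with rfl | hd
    · refine ⟨0, a 0, ha0, fun z hz _ => ?_⟩
      have := heq z hz
      rw [Finset.sum_range_one] at this
      simp only [pow_zero, pow_one] at this
      rw [mul_comm, this, Polynomial.eval_zero]
    · obtain ⟨M, w, hM, hwU, hw, hwK⟩ := exists_root k hk z₀ hz₀ U hU hzU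
      have hK : 2 ≤ k ^ M := hk.trans (Nat.le_self_pow (by omega) k)
      obtain ⟨c, hc, hrel⟩ := exists_rel k d M hk hd a had f heq
      obtain ⟨e, i, P, he, hP0, hPe, hrel'⟩ := exists_rel' (k ^ M) d hK f c hc hrel
      exact final_aux (k ^ M) e i hK he P hP0 hPe f hf0 hrel' w hw hwK U hU hwU g hg hfg
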